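/- arXiv:0704.1533 — 8 statements merged into one kernel-verified Lean document; each statement's English description precedes it below -/
import Mathlib

section
/- Let H be an abelian group and let μ₁, μ₂ be normalized scalar 2-cocycles on H. Then μ₁ and μ₂ are cohomologous if and only if μ₁*μ₁ = μ₂*μ₂, i.e. conj(μ₁(h,g))·μ₁(g,h) = conj(μ₂(h,g))·μ₂(g,h) for all g, h ∈ H. -/
/-- A normalized scalar 2-cocycle on an abelian group `H`, modelled as a map
`H × H → ℂ` taking values in the circle group `𝕋 = {z : ℂ | ‖z‖ = 1}`. -/
def IsNormalized2Cocycle {H : Type*} [AddCommGroup H] (μ : H → H → ℂ) : Prop :=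
  (∀ g h, ‖μ g h‖ = 1) ∧ (∀ g, μ g 0 = 1) ∧ (∀ g, μ 0 g = 1) ∧
    ∀ g h k, μ g h * μ (g + h) k = μ h k * μ g (h + k)

/-- Two normalized scalar 2-cocycles are cohomologous if they differ by the
coboundary of a `𝕋`-valued map `b` with `b 0 = 1`. -/
def Cohomologous {H : Type*} [AddCommGroup H] (μ₁ μ₂ : H → H → ℂ) : Prop :=
  ∃ b : H → ℂ, (∀ g, ‖b g‖ = 1) ∧ b 0 = 1 ∧
    ∀ g h, μ₁ g h = b g * b h * (starRingEnd ℂ) (b (g + h)) * μ₂ g h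

/-- The extension of `H` by `A` determined by a 2-cocycle `c`. -/
structure CocycleExt {H A : Type*} (c : H → H → A) where
  fst : H
  snd : A

theorem symm_cocycle_trivial {H A : Type*} [AddCommGroup H] [AddCommGroup A]
    (hA : Module.Baer ℤ A) (c : H → H → A) (c0 : ∀ g, c g 0 = 0)
    (c0' : ∀ g, c 0 g = 0)
    (cs : ∀ g h, c g h = c h g)
    (cc : ∀ g h k, c g h + c (g + h) k = c h k + c g (h + k)) :
    ∃ b : H → A, b 0 = 0 ∧ ∀ g h, c g h = b g + b h - b (g + h) := by
  let _ : Add (CocycleExt c) := ⟨fun x y => ⟨x.fst + y.fst, x.snd + y.snd + c x.fst y.fst⟩⟩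
  let _ : Zero (CocycleExt c) := ⟨⟨0, 0⟩⟩
  let _ : Neg (CocycleExt c) := ⟨fun x => ⟨-x.fst, -x.snd - c (-x.fst) x.fst⟩⟩
  have add_def : ∀ x y : CocycleExt c,
      x + y = ⟨x.fst + y.fst, x.snd + y.snd + c x.fst y.fst⟩ := fun _ _ => rfl
  have zero_def : (0 : CocycleExt c) = ⟨0, 0⟩ := rfl
  have neg_def : ∀ x : CocycleExt c, -x = ⟨-x.fst, -x.snd - c (-x.fst) x.fst⟩ := fun _ => rfl
  let _ : AddCommGroup (CocycleExt c) :=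
    { add_assoc := by
        intro x y z
        simp only [add_def, CocycleExt.mk.injEq]
        refine ⟨add_assoc _ _ _, ?_⟩
        have := cc x.fst y.fst z.fst
        calc x.snd + y.snd + c x.fst y.fst + z.snd + c (x.fst + y.fst) z.fst
            = x.snd + y.snd + z.snd + (c x.fst y.fst + c (x.fst + y.fst) z.fst) := by abel
          _ = _ := by rw [this]; abel
      zero_add := by intro x; simp [add_def, zero_def, c0']
      add_zero := by intro x; simp [add_def, zero_def, c0]
      nsmul := nsmulRec
      zsmul := zsmulRec
      neg_add_cancel := by intro x; simp only [add_def, zero_def, neg_def, neg_add_cancel, CocycleExt.mk.injEq, true_and]; abel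
      add_comm := by
        intro x y
        simp only [add_def, CocycleExt.mk.injEq]
        exact ⟨add_comm _ _, by rw [cs, add_comm x.snd]⟩ }
  let i : A →+ CocycleExt c :=
    { toFun := fun a => ⟨0, a⟩
      map_zero' := rfl
      map_add' := by intro a b; simp [add_def, c0] }
  have hi : Function.Injective i.toIntLinearMap := by
    intro a b hab
    exact congrArg CocycleExt.snd hab
  obtain ⟨φ, hφ⟩ := hA.extension_property i.toIntLinearMap hi LinearMap.id
  have hφ' : ∀ a, φ ⟨0, a⟩ = a := fun a => LinearMap.congr_fun hφ a
  refine ⟨fun g => φ ⟨g, 0⟩, hφ' 0, fun g h => ?_⟩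
  have e : (⟨g, 0⟩ : CocycleExt c) + ⟨h, 0⟩ = ⟨g + h, 0⟩ + ⟨0, c g h⟩ := by
    simp [add_def, c0]
  have e2 := congrArg φ e
  rw [map_add, map_add, hφ'] at e2
  rw [e2]; abel

theorem baer_circle : Module.Baer ℤ (Additive Circle) := by
  have hs : ∀ n : ℤ, n ≠ 0 → ∀ z : Additive Circle, ∃ w : Additive Circle, n • w = z := by
    intro n hn z
    obtain ⟨t, ht⟩ : ∃ t, Circle.exp t = z.toMul := ⟨_, Circle.exp_arg z.toMul⟩
    refine ⟨Additive.ofMul (Circle.exp (t / n)), ?_⟩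
    apply Additive.toMul.injective
    rw [toMul_zsmul, toMul_ofMul, ← Circle.exp_zsmul, ← ht]
    congr 1
    have : (n : ℝ) ≠ 0 := by exact_mod_cast hn
    simp
    field_simp
  classical
  choose f hf using hs
  let _ : DivisibleBy (Additive Circle) ℤ :=
    { div := fun z n => if hn : n = 0 then 0 else f n hn z
      div_zero := by intro z; simp
      div_cancel := by intro n z hn; simp [hn, hf] }
  exact Module.Baer.of_divisible _

/-- Two normalized scalar 2-cocycles `μ₁`, `μ₂` on an abelian group `H` are cohomologous
if and only if `μ₁*μ₁ = μ₂*μ₂`, where `μ*μ(g,h) = conj(μ(h,g))·μ(g,h)`. -/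
theorem cohomologous_iff_bicharacter_eq {H : Type*} [AddCommGroup H]
    (μ₁ μ₂ : H → H → ℂ) (h₁ : IsNormalized2Cocycle μ₁) (h₂ : IsNormalized2Cocycle μ₂) :
    Cohomologous μ₁ μ₂ ↔
      ∀ g h, (starRingEnd ℂ) (μ₁ h g) * μ₁ g h = (starRingEnd ℂ) (μ₂ h g) * μ₂ g h := by
  obtain ⟨n₁, r₁, l₁, k₁⟩ := h₁
  obtain ⟨n₂, r₂, l₂, k₂⟩ := h₂
  have cinv : ∀ z : ℂ, ‖z‖ = 1 → (starRingEnd ℂ) z = z⁻¹ := fun z hz =>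
    (Complex.inv_eq_conj hz).symm
  have nz : ∀ z : ℂ, ‖z‖ = 1 → z ≠ 0 := by
    rintro z hz rfl
    simp at hz
  have z₁ := fun g h => nz _ (n₁ g h)
  have z₂ := fun g h => nz _ (n₂ g h)
  constructor
  · rintro ⟨b, nb, b0, hb⟩ g h
    have zb := fun g => nz _ (nb g)
    rw [cinv _ (n₁ h g), cinv _ (n₂ h g), hb g h, hb h g, cinv _ (nb _), cinv _ (nb _),
      add_comm h g]
    have := zb g
    have := zb h
    have := zb (g + h)
    have := z₂ g h
    have := z₂ h g
    field_simp
  · intro hs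
    have nd : ∀ g h, ‖μ₁ g h / μ₂ g h‖ = 1 := by intro g h; simp [n₁, n₂]
    let d : H → H → Circle := fun g h => ⟨μ₁ g h / μ₂ g h, mem_sphere_zero_iff_norm.2 (nd g h)⟩
    have dc : ∀ g h, (d g h : ℂ) = μ₁ g h / μ₂ g h := fun _ _ => rfl
    obtain ⟨b, b0, hb⟩ := symm_cocycle_trivial baer_circle
      (fun g h => Additive.ofMul (d g h))
      (fun g => congrArg Additive.ofMul (by ext; simp [dc, r₁, r₂] : d g 0 = 1))
      (fun g => congrArg Additive.ofMul (by ext; simp [dc, l₁, l₂] : d 0 g = 1))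
      (fun g h => congrArg Additive.ofMul (by
        ext
        rw [dc, dc]
        have e := hs g h
        rw [cinv _ (n₁ h g), cinv _ (n₂ h g)] at e
        have := z₁ h g
        have := z₂ g h
        have := z₂ h g
        field_simp at e ⊢
        linear_combination e))
      (fun g h k => congrArg Additive.ofMul (by
        ext
        rw [Circle.coe_mul, Circle.coe_mul, dc, dc, dc, dc, div_mul_div_comm, div_mul_div_comm,
          k₁, k₂] : d g h * d (g + h) k = d h k * d g (h + k)))
    refine ⟨fun g => ((b g).toMul : ℂ), fun g => Circle.norm_coe _, ?_, fun g h => ?_⟩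
    · simp [b0]
    · have e : d g h = (b g).toMul * (b h).toMul / (b (g + h)).toMul :=
        congrArg Additive.toMul (hb g h)
      have e' := congrArg (fun z : Circle => (z : ℂ)) e
      simp only [dc, Circle.coe_mul, Circle.coe_div] at e'
      rw [cinv _ (Circle.norm_coe _), ← div_eq_mul_inv, ← e', div_mul_cancel₀ _ (z₂ g h)]
end

section
/- Let G ⊆ Γ be an inclusion of countable discrete groups. Then the pair (Γ, G) has the relative property (T) if and only if the following holds: for every ε > 0 there exist a finite subset F ⊆ Γ and δ > 0 such that whenever π: Γ → U(𝓗) is a unitary representation of Γ on a complex Hilbert space 𝓗 and ξ ∈ 𝓗 is a unit vector with ‖π(g)ξ − ξ‖ < δ for all g ∈ F, one has ‖π(h)ξ − ξ‖ < ε for all h ∈ G. -/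
/-- The pair `(Γ, G)` (a countable discrete group `Γ` with a subgroup `G`) has the
relative property (T) of Kazhdan: there are a finite set `F ⊆ Γ` and `δ > 0` such that
any unitary representation of `Γ` on a complex Hilbert space with a unit vector that is
`(F, δ)`-invariant admits a nonzero `G`-fixed vector. -/
def HasRelativePropertyT (Γ : Type) [Group Γ] (G : Subgroup Γ) : Prop :=
  ∃ (F : Finset Γ) (δ : ℝ), 0 < δ ∧
    ∀ (𝓗 : Type) [NormedAddCommGroup 𝓗] [InnerProductSpace ℂ 𝓗] [CompleteSpace 𝓗]
      (π : Γ →* (𝓗 ≃ₗᵢ[ℂ] 𝓗)) (ξ : 𝓗), ‖ξ‖ = 1 →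
      (∀ g ∈ F, ‖π g ξ - ξ‖ < δ) →
      ∃ η : 𝓗, η ≠ 0 ∧ ∀ h ∈ G, π h η = η


open scoped ComplexOrder InnerProductSpace
open Filter Topology

namespace RelT

lemma psd_gram {X H : Type*} [NormedAddCommGroup H] [InnerProductSpace ℂ H] (v : X → H) :
    (Matrix.of fun x y => ⟪v x, v y⟫_ℂ).PosSemidef := by
  refine ⟨?_, fun x => ?_⟩
  · ext i j
    simp
  · have : (x.sum fun i xi ↦ x.sum fun j xj ↦ star xi * (Matrix.of fun x y => ⟪v x, v y⟫_ℂ) i j * xj)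
        = ⟪x.sum fun i xi => xi • v i, x.sum fun i xi => xi • v i⟫_ℂ := by
      simp only [Finsupp.sum]
      rw [sum_inner]
      refine Finset.sum_congr rfl fun i _ => ?_
      rw [inner_smul_left, inner_sum, Finset.mul_sum]
      refine Finset.sum_congr rfl fun j _ => ?_
      rw [inner_smul_right]
      simp only [RCLike.star_def, Matrix.of_apply]
      ring
    rw [this, inner_self_eq_norm_sq_to_K]
    positivity

lemma psd_limit {X : Type*} {A : ℕ → Matrix X X ℂ} {B : Matrix X X ℂ}
    (hA : ∀ n, (A n).PosSemidef) (h : ∀ x y, Tendsto (fun n => A n x y) atTop (𝓝 (B x y))) :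
    B.PosSemidef := by
  refine ⟨?_, fun x => ?_⟩
  · ext i j
    have h1 : Tendsto (fun n => star (A n j i)) atTop (𝓝 (star (B j i))) :=
      (continuous_star.tendsto _).comp (h j i)
    refine tendsto_nhds_unique h1 ?_
    refine (h i j).congr fun n => ?_
    rw [(hA n).1.apply]
  · refine ge_of_tendsto' (x := atTop)
      (f := fun n => x.sum fun i xi ↦ x.sum fun j xj ↦ star xi * A n i j * xj) ?_
      (fun n => (hA n).2 x)
    simp only [Finsupp.sum]
    exact tendsto_finsetSum _ fun i _ => tendsto_finsetSum _ fun j _ =>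
      ((h i j).const_mul _).mul_const _

lemma psd_one {X : Type*} : (Matrix.of fun _ _ => (1 : ℂ) : Matrix X X ℂ).PosSemidef := by
  simpa using psd_gram (fun _ : X => (1 : ℂ))

lemma psd_smul {X : Type*} {A : Matrix X X ℂ} (hA : A.PosSemidef) {c : ℝ} (hc : 0 ≤ c) :
    (Matrix.of fun x y => (c : ℂ) * A x y).PosSemidef := by
  have := hA.smul (a := (c : ℂ)) (by exact_mod_cast hc)
  exact this

lemma psd_prod {X : Type*} {A : ℕ → Matrix X X ℂ} (hA : ∀ n, (A n).PosSemidef) (N : ℕ) :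
    (Matrix.of fun x y => ∏ k ∈ Finset.range N, A k x y).PosSemidef := by
  induction N with
  | zero => simpa using psd_one
  | succ n ih =>
    simp only [Finset.prod_range_succ]
    exact ih.hadamard (hA n)

lemma psd_exp {X : Type*} {A : Matrix X X ℂ} (hA : A.PosSemidef) :
    (Matrix.of fun x y => Complex.exp (A x y)).PosSemidef := by
  refine psd_limit (A := fun N => ∑ k ∈ Finset.range N,
    Matrix.of fun x y => (((k.factorial : ℝ)⁻¹ : ℝ) : ℂ) * (A x y) ^ k) ?_ ?_
  · intro N
    refine Matrix.posSemidef_sum _ fun k _ => ?_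
    refine psd_smul (A := Matrix.of fun x y => (A x y) ^ k) ?_ (by positivity)
    simpa using psd_prod (A := fun _ => A) (fun _ => hA) k
  · intro x y
    have := (NormedSpace.expSeries_div_hasSum_exp (A x y)).tendsto_sum_nat
    rw [← Complex.exp_eq_exp_ℂ] at this
    refine this.congr fun N => ?_
    simp only [Matrix.sum_apply, Matrix.of_apply]
    refine Finset.sum_congr rfl fun k _ => ?_
    push_cast
    rw [div_eq_inv_mul]

lemma psd_gauss {X H : Type*} [NormedAddCommGroup H] [InnerProductSpace ℂ H] (v : X → H)
    (hv : ∀ x, ‖v x‖ = 1) {c : ℝ} (hc : 0 ≤ c) :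
    (Matrix.of fun x y => ((Real.exp (-(c * ‖v x - v y‖ ^ 2)) : ℝ) : ℂ)).PosSemidef := by
  have h1 := psd_gram v
  have h2 := psd_smul (h1.add h1.transpose) hc
  have h3 := psd_smul (psd_exp h2) (Real.exp_pos (-(2 * c))).le
  convert h3 using 1
  ext x y
  simp only [Matrix.of_apply, Matrix.add_apply, Matrix.transpose_apply]
  have h4 : ⟪v x, v y⟫_ℂ + ⟪v y, v x⟫_ℂ = ((2 * (⟪v x, v y⟫_ℂ).re : ℝ) : ℂ) := by
    rw [← inner_conj_symm (v y) (v x), Complex.add_conj]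
  rw [h4, ← Complex.ofReal_mul, ← Complex.ofReal_exp, ← Complex.ofReal_mul, ← Real.exp_add]
  congr 2
  have := @norm_sub_sq ℂ H _ _ _ (v x) (v y)
  rw [this, hv, hv]
  simp only [RCLike.re_to_complex]
  ring

/-- Kolmogorov decomposition of a positive semidefinite kernel. -/
lemma exists_vectors {X : Type} {K : Matrix X X ℂ} (hK : K.PosSemidef) :
    ∃ (H : Type) (_ : NormedAddCommGroup H) (_ : InnerProductSpace ℂ H) (_ : CompleteSpace H)
      (v : X → H), (∀ x y, ⟪v x, v y⟫_ℂ = K x y) ∧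
        DenseRange (Finsupp.linearCombination ℂ v) := by
  let core : PreInnerProductSpace.Core ℂ (X →₀ ℂ) :=
    { inner := fun f g => f.sum fun x a => g.sum fun y b => star a * K x y * b
      conj_inner_symm := fun f g => by
        rw [Finsupp.sum_comm]
        simp only [map_finsuppSum]
        refine Finsupp.sum_congr fun x _ => Finsupp.sum_congr fun y _ => ?_
        rw [← hK.1.apply]
        simp only [RCLike.star_def, map_mul, Complex.conj_conj]
        ring
      add_left := fun f g h => by
        rw [Finsupp.sum_add_index'] <;> simp [← Finsupp.sum_add, add_mul]
      smul_left := fun f g r => by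
        rw [Finsupp.sum_smul_index] <;> simp [Finsupp.mul_sum, ← mul_assoc]
      re_inner_nonneg := fun f => by
        exact (Complex.nonneg_iff.1 (hK.2 f)).1 }
  let : SeminormedAddCommGroup (X →₀ ℂ) :=
    InnerProductSpace.Core.toSeminormedAddCommGroup (𝕜 := ℂ)
  let : InnerProductSpace ℂ (X →₀ ℂ) := .ofCore _
  have hdef : ∀ f g : X →₀ ℂ,
    ⟪f, g⟫_ℂ = f.sum fun x a => g.sum fun y b => star a * K x y * b := fun _ _ => rfl
  refine ⟨UniformSpace.Completion (X →₀ ℂ), inferInstance, inferInstance, inferInstance,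
    fun x => ((Finsupp.single x 1 : X →₀ ℂ) : UniformSpace.Completion (X →₀ ℂ)), ?_, ?_⟩
  · intro x y
    rw [UniformSpace.Completion.inner_coe, hdef]
    simp
  · have : ⇑(Finsupp.linearCombination ℂ fun x =>
        ((Finsupp.single x 1 : X →₀ ℂ) : UniformSpace.Completion (X →₀ ℂ)))
        = fun f : X →₀ ℂ => (f : UniformSpace.Completion (X →₀ ℂ)) := by
      have h2 : (Finsupp.linearCombination ℂ fun x =>
        ((Finsupp.single x 1 : X →₀ ℂ) : UniformSpace.Completion (X →₀ ℂ)))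
        = (UniformSpace.Completion.toComplₗᵢ (𝕜 := ℂ) (E := X →₀ ℂ)).toLinearMap := by
        ext x
        simp
      rw [h2]
      rfl
    rw [this]
    exact UniformSpace.Completion.denseRange_coe

/-- GNS construction for a positive definite function on a group. -/
lemma gns {Γ : Type} [Group Γ] (φ : Γ → ℂ)
    (hφ : (Matrix.of fun x y : Γ => φ (x⁻¹ * y)).PosSemidef) :
    ∃ (H : Type) (_ : NormedAddCommGroup H) (_ : InnerProductSpace ℂ H) (_ : CompleteSpace H)
      (π : Γ →* (H ≃ₗᵢ[ℂ] H)) (ξ : H), (∀ x y, ⟪π x ξ, π y ξ⟫_ℂ = φ (x⁻¹ * y)) ∧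
        DenseRange (Finsupp.linearCombination ℂ fun x => π x ξ) := by
  obtain ⟨H, _, _, _, v, hv, hd⟩ := exists_vectors hφ
  set e := Finsupp.linearCombination ℂ v with he
  let f : Γ → ((Γ →₀ ℂ) ≃ₗ[ℂ] (Γ →₀ ℂ)) := fun g => Finsupp.domLCongr (Equiv.mulLeft g)
  have hn : ∀ g x, ‖e (f g x)‖ = ‖e x‖ := by
    intro g x
    have h1 : e (f g x) = x.sum fun i a => a • v (g * i) := by
      simp only [f, he, Finsupp.domLCongr_apply, Finsupp.domCongr_apply,
        Finsupp.linearCombination_apply, Finsupp.equivMapDomain_eq_mapDomain]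
      rw [Finsupp.sum_mapDomain_index] <;> simp [add_smul]
    have h2 : e x = x.sum fun i a => a • v i := by
      simp only [he, Finsupp.linearCombination_apply]
    have h3 : ⟪e (f g x), e (f g x)⟫_ℂ = ⟪e x, e x⟫_ℂ := by
      rw [h1, h2]
      simp only [Finsupp.sum, sum_inner, inner_sum, inner_smul_left, inner_smul_right, hv,
        Matrix.of_apply]
      simp [mul_assoc]
    rw [@norm_eq_sqrt_re_inner ℂ, @norm_eq_sqrt_re_inner ℂ, h3]
  let U : Γ → (H ≃ₗᵢ[ℂ] H) := fun g => (f g).extendOfIsometry e e hd hd (hn g)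
  have hU : ∀ g x, U g (v x) = v (g * x) := by
    intro g x
    have := LinearEquiv.extendOfIsometry_eq (f g) e e hd hd (hn g) (Finsupp.single x 1)
    simpa [he, f] using this
  have hext : ∀ A B : H ≃ₗᵢ[ℂ] H, (∀ x, A (v x) = B (v x)) → A = B := by
    intro A B h
    ext w
    refine congrFun (hd.equalizer A.continuous B.continuous ?_) w
    ext x
    simp [he, Finsupp.linearCombination_apply, Finsupp.sum, h]
  let π : Γ →* (H ≃ₗᵢ[ℂ] H) :=
    { toFun := U
      map_one' := hext _ _ fun x => by simp [hU]
      map_mul' := fun a b => hext _ _ fun x => by simp [hU, mul_assoc] }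
  have hπ : ∀ x, π x (v 1) = v x := fun x => by
    change U x (v 1) = v x
    simp [hU]
  refine ⟨H, _, _, ‹_›, π, v 1, ?_, ?_⟩
  · intro x y
    rw [hπ, hπ, hv]; rfl
  · simpa only [hπ] using hd

/-- The negative type functions used below. -/
def Good {Γ : Type} [Group Γ] (ψ : Γ → ℝ) : Prop :=
  (∀ g, 0 ≤ ψ g) ∧ ψ 1 = 0 ∧ (∀ x y, ψ (x * y) ≤ 2 * ψ x + 2 * ψ y) ∧
    ∀ c : ℝ, 0 ≤ c →
      (Matrix.of fun x y : Γ => ((Real.exp (-(c * ψ (x⁻¹ * y))) : ℝ) : ℂ)).PosSemidef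

lemma good_of_rep {Γ : Type} [Group Γ] {H : Type} [NormedAddCommGroup H] [InnerProductSpace ℂ H]
    (π : Γ →* (H ≃ₗᵢ[ℂ] H)) (ξ : H) (hξ : ‖ξ‖ = 1) : Good fun g => ‖π g ξ - ξ‖ ^ 2 := by
  refine ⟨fun g => by positivity, by simp, fun x y => ?_, fun c hc => ?_⟩
  · have h1 : π (x * y) ξ - ξ = π x (π y ξ - ξ) + (π x ξ - ξ) := by
      rw [map_sub, map_mul]
      change π x (π y ξ) - ξ = _
      abel
    have h2 : ‖π (x * y) ξ - ξ‖ ≤ ‖π y ξ - ξ‖ + ‖π x ξ - ξ‖ := by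
      rw [h1]
      refine (norm_add_le _ _).trans ?_
      rw [LinearIsometryEquiv.norm_map]
    change ‖π (x * y) ξ - ξ‖ ^ 2 ≤ 2 * ‖π x ξ - ξ‖ ^ 2 + 2 * ‖π y ξ - ξ‖ ^ 2
    have h3 := norm_nonneg (π (x * y) ξ - ξ)
    nlinarith [sq_nonneg (‖π y ξ - ξ‖ - ‖π x ξ - ξ‖)]
  · have := psd_gauss (fun g => π g ξ) (fun g => by simp [hξ]) hc
    convert this using 1
    ext x y
    have h1 : π y ξ - π x ξ = π x (π (x⁻¹ * y) ξ - ξ) := by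
      have h2 : π x (π (x⁻¹ * y) ξ) = π (x * (x⁻¹ * y)) ξ := by
        rw [map_mul π x]
        rfl
      rw [map_sub, h2, mul_inv_cancel_left]
    simp only [Matrix.of_apply]
    rw [norm_sub_rev (π x ξ), h1, LinearIsometryEquiv.norm_map]

lemma good_tsum {Γ : Type} [Group Γ] (ψ : ℕ → Γ → ℝ) (hψ : ∀ n, Good (ψ n)) (w : ℕ → ℝ)
    (hw : ∀ n, 0 ≤ w n) (hs : ∀ g, Summable fun n => w n * ψ n g) :
    Good fun g => ∑' n, w n * ψ n g := by
  refine ⟨fun g => tsum_nonneg fun n => mul_nonneg (hw n) ((hψ n).1 g), ?_, fun x y => ?_,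
    fun c hc => ?_⟩
  · simp [(hψ _).2.1]
  · rw [← tsum_mul_left, ← tsum_mul_left, ← ((hs x).mul_left 2).tsum_add ((hs y).mul_left 2)]
    refine (hs _).tsum_le_tsum (fun n => ?_) (((hs x).mul_left 2).add ((hs y).mul_left 2))
    nlinarith [mul_le_mul_of_nonneg_left ((hψ n).2.2.1 x y) (hw n)]
  · refine psd_limit (A := fun N => Matrix.of fun x y => ∏ k ∈ Finset.range N,
      ((Real.exp (-(c * w k * ψ k (x⁻¹ * y))) : ℝ) : ℂ)) (fun N => ?_) (fun x y => ?_)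
    · exact psd_prod (A := fun k => Matrix.of fun x y : Γ =>
        ((Real.exp (-(c * w k * ψ k (x⁻¹ * y))) : ℝ) : ℂ))
        (fun k => (hψ k).2.2.2 _ (mul_nonneg hc (hw k))) N
    · simp only [Matrix.of_apply]
      have h1 := (hs (x⁻¹ * y)).hasSum.tendsto_sum_nat
      have h2 := (Complex.continuous_ofReal.tendsto _).comp
        ((Real.continuous_exp.tendsto _).comp (h1.const_mul c).neg)
      refine h2.congr fun N => ?_
      simp only [Function.comp_apply]
      rw [← Complex.ofReal_prod, ← Real.exp_sum, Finset.mul_sum, ← Finset.sum_neg_distrib]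
      simp only [mul_assoc]

/-- A representation whose matrix coefficients on a total set vanish along `h n` has no
nonzero vectors fixed by all `h n`. -/
lemma no_fixed {Γ H : Type} [Group Γ] [NormedAddCommGroup H] [InnerProductSpace ℂ H]
    (π : Γ →* (H ≃ₗᵢ[ℂ] H)) (ξ : H)
    (hd : DenseRange (Finsupp.linearCombination ℂ fun x => π x ξ)) (h : ℕ → Γ)
    (hlim : ∀ x y, Tendsto (fun n => ⟪π x ξ, π (h n) (π y ξ)⟫_ℂ) atTop (𝓝 0))
    (η : H) (hη : ∀ n, π (h n) η = η) : η = 0 := by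
  have key : ∀ a : Γ →₀ ℂ, Tendsto (fun n =>
      ⟪Finsupp.linearCombination ℂ (fun x => π x ξ) a,
        π (h n) (Finsupp.linearCombination ℂ (fun x => π x ξ) a)⟫_ℂ) atTop (𝓝 0) := by
    intro a
    simp only [Finsupp.linearCombination_apply, Finsupp.sum, map_sum, map_smul, sum_inner,
      inner_sum, inner_smul_left, inner_smul_right]
    rw [show (0 : ℂ) = ∑ i ∈ a.support, a i * ∑ j ∈ a.support, (starRingEnd ℂ) (a j) * 0 by simp]
    refine tendsto_finsetSum _ fun i _ => Tendsto.const_mul _ ?_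
    exact tendsto_finsetSum _ fun j _ => Tendsto.const_mul _ (hlim _ _)
  by_contra hne
  have hpos : 0 < ‖η‖ := norm_pos_iff.2 hne
  obtain ⟨a, ha⟩ := hd.exists_dist_lt η (ε := ‖η‖ / 4) (by positivity)
  set v := Finsupp.linearCombination ℂ (fun x => π x ξ) a
  rw [dist_eq_norm] at ha
  have hv : ‖v‖ ≤ 2 * ‖η‖ := by
    have : ‖v‖ ≤ ‖η‖ + ‖η - v‖ := by
      have h0 := norm_sub_norm_le v η
      rw [norm_sub_rev] at h0
      linarith
    linarith
  have hb : ∀ n, ‖η‖ ^ 2 / 4 ≤ ‖⟪v, π (h n) v⟫_ℂ‖ := by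
    intro n
    have h1 : ⟪η, η⟫_ℂ = ⟪v, π (h n) v⟫_ℂ + ⟪η - v, η⟫_ℂ + ⟪v, π (h n) (η - v)⟫_ℂ := by
      rw [map_sub, hη, inner_sub_left, inner_sub_right]
      ring
    have h2 : ‖η‖ ^ 2 = ‖⟪η, η⟫_ℂ‖ := by
      rw [inner_self_eq_norm_sq_to_K]; simp
    have h3 : ‖⟪η - v, η⟫_ℂ‖ ≤ ‖η‖ / 4 * ‖η‖ :=
      (norm_inner_le_norm _ _).trans (by gcongr)
    have h4 : ‖⟪v, π (h n) (η - v)⟫_ℂ‖ ≤ (2 * ‖η‖) * (‖η‖ / 4) :=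
      (norm_inner_le_norm _ _).trans (by rw [LinearIsometryEquiv.norm_map]; gcongr)
    have h5 := norm_add₃_le (a := ⟪v, π (h n) v⟫_ℂ) (b := ⟪η - v, η⟫_ℂ)
      (c := ⟪v, π (h n) (η - v)⟫_ℂ)
    rw [← h1, ← h2] at h5
    nlinarith
  have := ge_of_tendsto' (key a).norm hb
  simp only [norm_zero] at this
  nlinarith

/-- The min-norm argument. -/
lemma exists_fixed {Γ H : Type} [Group Γ] [NormedAddCommGroup H] [InnerProductSpace ℂ H]
    [CompleteSpace H] (π : Γ →* (H ≃ₗᵢ[ℂ] H)) (G : Subgroup Γ) (ξ : H) (hξ : ‖ξ‖ = 1)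
    (h : ∀ g ∈ G, ‖π g ξ - ξ‖ < 1 / 2) : ∃ η : H, η ≠ 0 ∧ ∀ g ∈ G, π g η = η := by
  let _ : InnerProductSpace ℝ H := InnerProductSpace.complexToReal
  let S : Set H := {w | ∃ g ∈ G, π g ξ = w}
  let C := closedConvexHull ℝ S
  have hCc : Convex ℝ C := convex_closedConvexHull
  have hCl : IsClosed C := isClosed_closedConvexHull
  have hSC : S ⊆ C := subset_closedConvexHull
  have hξC : ξ ∈ C := hSC ⟨1, G.one_mem, by simp⟩
  have hball : C ⊆ Metric.closedBall ξ (1 / 2) := by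
    refine closedConvexHull_min ?_ (convex_closedBall _ _) Metric.isClosed_closedBall
    rintro _ ⟨g, hg, rfl⟩
    rw [Metric.mem_closedBall, dist_eq_norm]
    exact (h g hg).le
  have hinv : ∀ g ∈ G, ∀ w ∈ C, π g w ∈ C := by
    intro g hg
    have : C ⊆ (π g) ⁻¹' C := by
      refine closedConvexHull_min ?_ ?_ (hCl.preimage (π g).continuous)
      · rintro _ ⟨k, hk, rfl⟩
        exact hSC ⟨g * k, G.mul_mem hg hk, by simp⟩
      · intro x hx y hy a b ha hb hab
        simp only [Set.mem_preimage, map_add] at *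
        have e1 : ∀ (r : ℝ) (z : H), π g (r • z) = r • π g z := fun r z => by
          rw [← Complex.coe_smul, map_smul, Complex.coe_smul]
        rw [e1, e1]
        exact hCc hx hy ha hb hab
    exact this
  obtain ⟨η, hηC, hη⟩ := exists_norm_eq_iInf_of_complete_convex ⟨ξ, hξC⟩ hCl.isComplete hCc 0
  have hmin := (norm_eq_iInf_iff_real_inner_le_zero hCc hηC).1 hη
  refine ⟨η, ?_, fun g hg => ?_⟩
  · rintro rfl
    have := hball hηC
    rw [Metric.mem_closedBall, dist_eq_norm, zero_sub, norm_neg, hξ] at this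
    norm_num at this
  · have h1 := hmin _ (hinv g hg η hηC)
    have h2 := norm_sub_sq_real (π g η) η
    rw [LinearIsometryEquiv.norm_map] at h2
    rw [zero_sub, inner_neg_left, inner_sub_right, real_inner_self_eq_norm_sq,
      real_inner_comm] at h1
    have h3 : ‖π g η - η‖ ^ 2 ≤ 0 := by linarith
    have h4 : ‖π g η - η‖ = 0 := by nlinarith [norm_nonneg (π g η - η)]
    exact sub_eq_zero.1 (norm_eq_zero.1 h4)

lemma not_T {Γ : Type} [Group Γ] [Countable Γ] (G : Subgroup Γ) {ε : ℝ} (hε : 0 < ε)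
    (H : ∀ (F : Finset Γ) (δ : ℝ), 0 < δ → ∃ ψ : Γ → ℝ, Good ψ ∧ (∀ g ∈ F, ψ g < δ) ∧
      ∃ h ∈ G, ε ≤ ψ h) : ¬ HasRelativePropertyT Γ G := by
  classical
  rintro ⟨F, δ, hδ, hT⟩
  obtain ⟨e, he⟩ := exists_surjective_nat Γ
  choose ψ hgood hsmall h hG hbig using
    fun n : ℕ => H ((Finset.range (n + 1)).image e) ((1 / 4) ^ n) (by positivity)
  have hs : ∀ g, Summable fun n => (2 : ℝ) ^ n * ψ n g := by
    intro g
    obtain ⟨k, rfl⟩ := he g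
    refine Summable.of_norm_bounded_eventually_nat (g := fun n => (1 / 2 : ℝ) ^ n)
      summable_geometric_two ?_
    filter_upwards [eventually_ge_atTop k] with n hn
    have h1 := hsmall n (e k) (Finset.mem_image_of_mem _ (Finset.mem_range.2 (by omega)))
    have h0 := (hgood n).1 (e k)
    rw [Real.norm_of_nonneg (by positivity)]
    calc (2 : ℝ) ^ n * ψ n (e k) ≤ 2 ^ n * (1 / 4) ^ n := by gcongr
      _ = (1 / 2) ^ n := by rw [← mul_pow]; norm_num
  have hΨ := good_tsum ψ hgood (fun n => 2 ^ n) (fun n => by positivity) hs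
  set Ψ : Γ → ℝ := fun g => ∑' n, (2 : ℝ) ^ n * ψ n g with hΨdef
  obtain ⟨hΨ0, hΨ1, hΨm, hΨp⟩ := hΨ
  have hΨh : Tendsto (fun n => Ψ (h n)) atTop atTop := by
    refine tendsto_atTop_mono (f := fun n => (2 : ℝ) ^ n * ε) (fun n => ?_) ?_
    · have h1 : (2 : ℝ) ^ n * ψ n (h n) ≤ Ψ (h n) :=
        (hs (h n)).le_tsum n fun j _ => mul_nonneg (by positivity) ((hgood j).1 _)
      refine le_trans ?_ h1
      gcongr
      exact hbig n
    · exact (tendsto_pow_atTop_atTop_of_one_lt (by norm_num)).atTop_mul_const hε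
  have hΨxy : ∀ x y, Tendsto (fun n => Ψ (x⁻¹ * (h n * y))) atTop atTop := by
    intro x y
    have h1 : ∀ n, (Ψ (h n) + (- (2 * Ψ x) - 4 * Ψ y⁻¹)) / 4 ≤ Ψ (x⁻¹ * (h n * y)) := by
      intro n
      have e1 := hΨm x (x⁻¹ * h n)
      have e2 := hΨm (x⁻¹ * (h n * y)) y⁻¹
      rw [show x * (x⁻¹ * h n) = h n by group] at e1
      rw [show x⁻¹ * (h n * y) * y⁻¹ = x⁻¹ * h n by group] at e2
      linarith
    exact tendsto_atTop_mono h1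
      ((tendsto_atTop_add_const_right _ _ hΨh).atTop_div_const (by norm_num))
  obtain ⟨t, ht, htF⟩ : ∃ t : ℝ, 0 < t ∧ ∀ g ∈ F, 2 - 2 * Real.exp (-(t * Ψ g)) < δ ^ 2 := by
    have h1 : ∀ᶠ t in 𝓝[>] (0 : ℝ), ∀ g ∈ F, 2 - 2 * Real.exp (-(t * Ψ g)) < δ ^ 2 := by
      rw [Filter.eventually_all_finset]
      intro g _
      have hc : Continuous fun t : ℝ => 2 - 2 * Real.exp (-(t * Ψ g)) := by fun_prop
      have h2 := hc.tendsto 0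
      simp only [zero_mul, neg_zero, Real.exp_zero, mul_one, sub_self] at h2
      exact (h2.mono_left nhdsWithin_le_nhds).eventually_lt_const (by positivity)
    obtain ⟨t, h2, h3⟩ := (h1.and self_mem_nhdsWithin).exists
    exact ⟨t, h3, h2⟩
  obtain ⟨𝓗, _, _, _, π, ξ, hin, hd⟩ :=
    gns (fun g => ((Real.exp (-(t * Ψ g)) : ℝ) : ℂ)) (hΨp t ht.le)
  have hin1 : ∀ g, ⟪π g ξ, ξ⟫_ℂ = ((Real.exp (-(t * Ψ g⁻¹)) : ℝ) : ℂ) := by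
    intro g
    simpa using hin g 1
  have hin2 : ∀ g, ⟪ξ, π g ξ⟫_ℂ = ((Real.exp (-(t * Ψ g)) : ℝ) : ℂ) := by
    intro g
    simpa using hin 1 g
  have hξ : ‖ξ‖ = 1 := by
    have h1 := hin2 1
    rw [hΨ1] at h1
    simp only [map_one, LinearIsometryEquiv.coe_one, id_eq, mul_zero, neg_zero, Real.exp_zero,
      Complex.ofReal_one] at h1
    rw [@norm_eq_sqrt_re_inner ℂ, h1]
    simp
  obtain ⟨η, hη0, hη⟩ := hT 𝓗 π ξ hξ (by
    intro g hg
    have h1 := @norm_sub_sq ℂ 𝓗 _ _ _ (π g ξ) ξ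
    rw [LinearIsometryEquiv.norm_map, hξ, inner_re_symm, hin2] at h1
    simp only [RCLike.re_to_complex, Complex.ofReal_re] at h1
    have h2 := htF g hg
    refine lt_of_pow_lt_pow_left₀ 2 hδ.le ?_
    linarith)
  refine hη0 (no_fixed π ξ hd h (fun x y => ?_) η (fun n => hη _ (hG n)))
  have h1 : ∀ n, ⟪π x ξ, π (h n) (π y ξ)⟫_ℂ
      = ((Real.exp (-(t * Ψ (x⁻¹ * (h n * y)))) : ℝ) : ℂ) := by
    intro n
    rw [← hin x (h n * y), map_mul]
    rfl
  simp only [h1]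
  have h2 : Tendsto (fun n => Real.exp (-(t * Ψ (x⁻¹ * (h n * y))))) atTop (𝓝 0) :=
    Real.tendsto_exp_neg_atTop_nhds_zero.comp ((hΨxy x y).const_mul_atTop ht)
  have h3 := (Complex.continuous_ofReal.tendsto 0).comp h2
  rw [Complex.ofReal_zero] at h3
  exact h3

end RelT

/-- (Jolissaint) The pair `(Γ, G)` has the relative property (T) if and only if:
for every `ε > 0` there are a finite set `F ⊆ Γ` and `δ > 0` such that for any unitary
representation `π` of `Γ` on a complex Hilbert space and any unit vector `ξ` with
`‖π(g)ξ - ξ‖ < δ` for all `g ∈ F`, one has `‖π(h)ξ - ξ‖ < ε` for all `h ∈ G`. -/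
theorem hasRelativePropertyT_iff (Γ : Type) [Group Γ] [Countable Γ] (G : Subgroup Γ) :
    HasRelativePropertyT Γ G ↔
      ∀ ε : ℝ, 0 < ε →
        ∃ (F : Finset Γ) (δ : ℝ), 0 < δ ∧
          ∀ (𝓗 : Type) [NormedAddCommGroup 𝓗] [InnerProductSpace ℂ 𝓗] [CompleteSpace 𝓗]
            (π : Γ →* (𝓗 ≃ₗᵢ[ℂ] 𝓗)) (ξ : 𝓗), ‖ξ‖ = 1 →
            (∀ g ∈ F, ‖π g ξ - ξ‖ < δ) →
            ∀ h ∈ G, ‖π h ξ - ξ‖ < ε := by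
  constructor
  · intro hT ε hε
    by_contra hcon
    refine RelT.not_T G (ε := ε ^ 2) (by positivity) (fun F δ hδ => ?_) hT
    by_contra hno
    refine hcon ⟨F, Real.sqrt δ, Real.sqrt_pos.2 hδ, ?_⟩
    intro 𝓗 _ _ _ π ξ hξ hF h hh
    by_contra hlt
    refine hno ⟨_, RelT.good_of_rep π ξ hξ, fun g hg => ?_, h, hh, ?_⟩
    · exact (Real.lt_sqrt (norm_nonneg _)).1 (hF g hg)
    · have := not_lt.1 hlt
      gcongr
  · intro hyp
    obtain ⟨F, δ, hδ, h⟩ := hyp (1 / 2) (by norm_num)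
    refine ⟨F, δ, hδ, ?_⟩
    intro 𝓗 _ _ _ π ξ hξ hF
    exact RelT.exists_fixed π G ξ hξ (h 𝓗 π ξ hξ hF)
end

section
/- Let H be an abelian group, fix a bijection ℕ → ℤ², j ↦ k_j, and let μ and μ₀ be normalized scalar 2-cocycles on H that are cohomologous. Then for all λ₁, λ₂ ∈ Λ(H): μ̃(λ₁,λ₂)·conj(μ̂(λ₁))·conj(μ̂(λ₂))·μ̂(λ₁+λ₂) = μ̃₀(λ₁,λ₂)·conj(μ̂₀(λ₁))·conj(μ̂₀(λ₂))·μ̂₀(λ₁+λ₂), where μ̂, μ̃ are the functions built from μ and μ̂₀, μ̃₀ those built from μ₀. -/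
/-- `λ ∈ Λ(H)`: a finitely supported function `λ : ℤ² → H` with `∑_{k} λ(k) = 0`. -/
def InLambda {H : Type*} [AddCommGroup H] (l : (Fin 2 → ℤ) →₀ H) : Prop :=
  ∑ k ∈ l.support, l k = 0

/-- `μ̃(λ₁,λ₂) = ∏_{k ∈ ℤ²} μ(λ₁(k), λ₂(k))` (all but finitely many factors are `1`). -/
noncomputable def tilde2Cocycle {H : Type*} [AddCommGroup H] (μ : H → H → ℂ)
    (l₁ l₂ : (Fin 2 → ℤ) →₀ H) : ℂ :=
  ∏ᶠ k : Fin 2 → ℤ, μ (l₁ k) (l₂ k)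

/-- Given a bijection `ℕ ≃ ℤ²`, `j ↦ k_j`,
`μ̂(λ) = ∏_j μ(∑_{i<j} λ(k_i), λ(k_j))` (all but finitely many factors are `1`). -/
noncomputable def hat2Cocycle {H : Type*} [AddCommGroup H] (e : ℕ ≃ (Fin 2 → ℤ))
    (μ : H → H → ℂ) (l : (Fin 2 → ℤ) →₀ H) : ℂ :=
  ∏ᶠ j : ℕ, μ (∑ i ∈ Finset.range j, l (e i)) (l (e j))

theorem hat_eq_prod {H : Type*} [AddCommGroup H] (e : ℕ ≃ (Fin 2 → ℤ)) (μ : H → H → ℂ)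
    (hμ : IsNormalized2Cocycle μ) (l : (Fin 2 → ℤ) →₀ H) (N : ℕ)
    (hN : ∀ j, N ≤ j → l (e j) = 0) :
    hat2Cocycle e μ l
      = ∏ j ∈ Finset.range N, μ (∑ i ∈ Finset.range j, l (e i)) (l (e j)) := by
  unfold hat2Cocycle
  apply finprod_eq_prod_of_mulSupport_subset
  intro j hj
  by_contra h
  apply hj
  have h2 : N ≤ j := by simpa using h
  show μ _ (l (e j)) = 1
  rw [hN j h2, hμ.2.1]

theorem tilde_eq_prod {H : Type*} [AddCommGroup H] (e : ℕ ≃ (Fin 2 → ℤ)) (μ : H → H → ℂ)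
    (hμ : IsNormalized2Cocycle μ) (l₁ l₂ : (Fin 2 → ℤ) →₀ H) (N : ℕ)
    (hN : ∀ j, N ≤ j → l₂ (e j) = 0) :
    tilde2Cocycle μ l₁ l₂ = ∏ j ∈ Finset.range N, μ (l₁ (e j)) (l₂ (e j)) := by
  unfold tilde2Cocycle
  rw [← finprod_comp_equiv e]
  apply finprod_eq_prod_of_mulSupport_subset
  intro j hj
  by_contra h
  apply hj
  have h2 : N ≤ j := by simpa using h
  show μ _ (l₂ (e j)) = 1
  rw [hN j h2, hμ.2.1]

theorem exists_bound {H : Type*} [AddCommGroup H] (e : ℕ ≃ (Fin 2 → ℤ))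
    (l : (Fin 2 → ℤ) →₀ H) : ∃ N, ∀ j, N ≤ j → l (e j) = 0 := by
  refine ⟨(l.support.image e.symm).sup id + 1, fun j hj => ?_⟩
  by_contra h
  have hm : j ∈ l.support.image e.symm :=
    Finset.mem_image.2 ⟨e j, Finsupp.mem_support_iff.2 h, by simp⟩
  have := Finset.le_sup (f := id) hm
  simp only [id] at this
  omega

theorem sum_range_zero {H : Type*} [AddCommGroup H] (e : ℕ ≃ (Fin 2 → ℤ))
    (l : (Fin 2 → ℤ) →₀ H) (h : InLambda l) (N : ℕ)
    (hN : ∀ j, N ≤ j → l (e j) = 0) : ∑ j ∈ Finset.range N, l (e j) = 0 := by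
  rw [← h]
  refine (Finset.sum_map (Finset.range N) e.toEmbedding (fun k => l k)).symm.trans ?_
  symm
  apply Finset.sum_subset
  · intro k hk
    rw [Finset.mem_map]
    refine ⟨e.symm k, ?_, by simp⟩
    by_contra hh
    have h2 : N ≤ e.symm k := by simpa using hh
    have := hN _ h2
    simp at this hk
    exact hk this
  · intro k _ hk
    simpa using hk

theorem partial_prod {H : Type*} [AddCommGroup H] (μ μ₀ : H → H → ℂ) (b : H → ℂ)
    (hb : ∀ g, b g * (starRingEnd ℂ) (b g) = 1) (hb0 : b 0 = 1)
    (hm : ∀ g h, μ g h = b g * b h * (starRingEnd ℂ) (b (g + h)) * μ₀ g h)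
    (f : ℕ → H) (n : ℕ) :
    ∏ j ∈ Finset.range n, μ (∑ i ∈ Finset.range j, f i) (f j)
      = (∏ j ∈ Finset.range n, b (f j)) * (starRingEnd ℂ) (b (∑ i ∈ Finset.range n, f i)) *
        ∏ j ∈ Finset.range n, μ₀ (∑ i ∈ Finset.range j, f i) (f j) := by
  induction n with
  | zero => simp [hb0]
  | succ n ih =>
    rw [Finset.prod_range_succ, ih, hm, Finset.prod_range_succ, Finset.prod_range_succ,
      Finset.sum_range_succ]
    have := hb (∑ i ∈ Finset.range n, f i)
    linear_combination (∏ j ∈ Finset.range n, b (f j)) *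
      (∏ j ∈ Finset.range n, μ₀ (∑ i ∈ Finset.range j, f i) (f j)) * b (f n) *
      (starRingEnd ℂ) (b (∑ i ∈ Finset.range n, f i + f n)) *
      μ₀ (∑ i ∈ Finset.range n, f i) (f n) * this

theorem hat_cohom {H : Type*} [AddCommGroup H] (e : ℕ ≃ (Fin 2 → ℤ)) (μ μ₀ : H → H → ℂ)
    (hμ : IsNormalized2Cocycle μ) (hμ₀ : IsNormalized2Cocycle μ₀) (b : H → ℂ)
    (hb : ∀ g, b g * (starRingEnd ℂ) (b g) = 1) (hb0 : b 0 = 1)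
    (hm : ∀ g h, μ g h = b g * b h * (starRingEnd ℂ) (b (g + h)) * μ₀ g h)
    (l : (Fin 2 → ℤ) →₀ H) (N : ℕ) (hN : ∀ j, N ≤ j → l (e j) = 0)
    (hs : ∑ j ∈ Finset.range N, l (e j) = 0) :
    hat2Cocycle e μ l = (∏ j ∈ Finset.range N, b (l (e j))) * hat2Cocycle e μ₀ l := by
  rw [hat_eq_prod e μ hμ l N hN, hat_eq_prod e μ₀ hμ₀ l N hN,
    partial_prod μ μ₀ b hb hb0 hm (fun j => l (e j)) N, hs, hb0]
  simp

/-- If `μ` and `μ₀` are cohomologous normalized scalar 2-cocycles on `H`, then for all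
`λ₁, λ₂ ∈ Λ(H)`:
`μ̃(λ₁,λ₂)·conj(μ̂(λ₁))·conj(μ̂(λ₂))·μ̂(λ₁+λ₂)
  = μ̃₀(λ₁,λ₂)·conj(μ̂₀(λ₁))·conj(μ̂₀(λ₂))·μ̂₀(λ₁+λ₂)`. -/
theorem tilde_hat_cohomologous_invariant {H : Type*} [AddCommGroup H]
    (e : ℕ ≃ (Fin 2 → ℤ)) (μ μ₀ : H → H → ℂ)
    (hμ : IsNormalized2Cocycle μ) (hμ₀ : IsNormalized2Cocycle μ₀)
    (hco : Cohomologous μ μ₀)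
    (l₁ l₂ : (Fin 2 → ℤ) →₀ H) (h₁ : InLambda l₁) (h₂ : InLambda l₂) :
    tilde2Cocycle μ l₁ l₂ * (starRingEnd ℂ) (hat2Cocycle e μ l₁) *
        (starRingEnd ℂ) (hat2Cocycle e μ l₂) * hat2Cocycle e μ (l₁ + l₂)
      = tilde2Cocycle μ₀ l₁ l₂ * (starRingEnd ℂ) (hat2Cocycle e μ₀ l₁) *
        (starRingEnd ℂ) (hat2Cocycle e μ₀ l₂) * hat2Cocycle e μ₀ (l₁ + l₂) := by
  obtain ⟨b, hb1, hb0, hm⟩ := hco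
  have hb : ∀ g, b g * (starRingEnd ℂ) (b g) = 1 := by
    intro g
    rw [Complex.mul_conj, Complex.normSq_eq_norm_sq, hb1]
    simp
  obtain ⟨N₁, hN₁⟩ := exists_bound e l₁
  obtain ⟨N₂, hN₂⟩ := exists_bound e l₂
  have k₁ : ∀ j, max N₁ N₂ ≤ j → l₁ (e j) = 0 := fun j hj => hN₁ j (by omega)
  have k₂ : ∀ j, max N₁ N₂ ≤ j → l₂ (e j) = 0 := fun j hj => hN₂ j (by omega)
  generalize max N₁ N₂ = N at k₁ k₂
  have k₃ : ∀ j, N ≤ j → (l₁ + l₂) (e j) = 0 := fun j hj => by simp [k₁ j hj, k₂ j hj]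
  have s₁ := sum_range_zero e l₁ h₁ N k₁
  have s₂ := sum_range_zero e l₂ h₂ N k₂
  have s₃ : ∑ j ∈ Finset.range N, (l₁ + l₂) (e j) = 0 := by
    simp [Finset.sum_add_distrib, s₁, s₂]
  have hB : ∀ l : (Fin 2 → ℤ) →₀ H, (∏ j ∈ Finset.range N, b (l (e j))) *
      (starRingEnd ℂ) (∏ j ∈ Finset.range N, b (l (e j))) = 1 := by
    intro l
    rw [map_prod, ← Finset.prod_mul_distrib]
    exact Finset.prod_eq_one fun j _ => hb _
  have ht : tilde2Cocycle μ l₁ l₂ = (∏ j ∈ Finset.range N, b (l₁ (e j))) *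
      (∏ j ∈ Finset.range N, b (l₂ (e j))) *
      (starRingEnd ℂ) (∏ j ∈ Finset.range N, b ((l₁ + l₂) (e j))) * tilde2Cocycle μ₀ l₁ l₂ := by
    rw [tilde_eq_prod e μ hμ l₁ l₂ N k₂, tilde_eq_prod e μ₀ hμ₀ l₁ l₂ N k₂, map_prod,
      ← Finset.prod_mul_distrib, ← Finset.prod_mul_distrib, ← Finset.prod_mul_distrib]
    exact Finset.prod_congr rfl fun j _ => hm _ _
  rw [ht, hat_cohom e μ μ₀ hμ hμ₀ b hb hb0 hm l₁ N k₁ s₁,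
    hat_cohom e μ μ₀ hμ hμ₀ b hb hb0 hm l₂ N k₂ s₂,
    hat_cohom e μ μ₀ hμ hμ₀ b hb hb0 hm (l₁ + l₂) N k₃ s₃, map_mul, map_mul]
  have e₁ := hB l₁
  have e₂ := hB l₂
  have e₃ := hB (l₁ + l₂)
  generalize (∏ j ∈ Finset.range N, b (l₁ (e j))) = B₁ at *
  generalize (∏ j ∈ Finset.range N, b (l₂ (e j))) = B₂ at *
  generalize (∏ j ∈ Finset.range N, b ((l₁ + l₂) (e j))) = B₃ at *
  generalize tilde2Cocycle μ₀ l₁ l₂ = T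
  generalize (starRingEnd ℂ) (hat2Cocycle e μ₀ l₁) = x
  generalize (starRingEnd ℂ) (hat2Cocycle e μ₀ l₂) = y
  generalize hat2Cocycle e μ₀ (l₁ + l₂) = z
  calc _ = (B₁ * (starRingEnd ℂ) B₁) * (B₂ * (starRingEnd ℂ) B₂) * (B₃ * (starRingEnd ℂ) B₃) *
        (T * x * y * z) := by ring
    _ = _ := by rw [e₁, e₂, e₃]; ring
end

section
/- Let H be an abelian group and χ a character of H. Then the set Γ₀ = Ĥ × ℤ² × SL(2,ℤ) equipped with the multiplication (c₁, k, γ₁)·(c₂, l, γ₂) = (c₁·c₂·χ^{det(k, γ₁·l)}, k + γ₁·l, γ₁γ₂) is a group, with identity (1, 0, I) where 1 is the trivial character and I the identity matrix. -/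
/-- `det(k, k₀) = q·r₀ - r·q₀` for `k = (q,r)`, `k₀ = (q₀,r₀)` in `ℤ²`. -/
def det2 (k k₀ : Fin 2 → ℤ) : ℤ := k 0 * k₀ 1 - k 1 * k₀ 0

/-- The group `Ĥ` of characters of the abelian group `H`, i.e. group homomorphisms
`H → 𝕋` (under pointwise multiplication). -/
abbrev CharGroup (H : Type*) [AddCommGroup H] := Multiplicative H →* Circle

/-- The underlying set `Γ₀ = Ĥ × ℤ² × SL(2,ℤ)`. -/
abbrev Gamma0 (H : Type*) [AddCommGroup H] :=
  CharGroup H × (Fin 2 → ℤ) × Matrix.SpecialLinearGroup (Fin 2) ℤ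

/-- The multiplication on `Γ₀`:
`(c₁, k, γ₁)·(c₂, l, γ₂) = (c₁·c₂·χ^{det(k, γ₁·l)}, k + γ₁·l, γ₁γ₂)`. -/
noncomputable def gamma0Mul {H : Type*} [AddCommGroup H] (χ : CharGroup H)
    (x y : Gamma0 H) : Gamma0 H :=
  (x.1 * y.1 * χ ^ det2 x.2.1 ((x.2.2 : Matrix (Fin 2) (Fin 2) ℤ).mulVec y.2.1),
    x.2.1 + (x.2.2 : Matrix (Fin 2) (Fin 2) ℤ).mulVec y.2.1,
    x.2.2 * y.2.2)

/-- The identity element `(1, 0, I)` of `Γ₀`, where `1` is the trivial character and `I`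
the identity matrix. -/
noncomputable def gamma0One (H : Type*) [AddCommGroup H] : Gamma0 H := (1, 0, 1)

theorem det2_add_left (a b c : Fin 2 → ℤ) : det2 (a + b) c = det2 a c + det2 b c := by
  simp only [det2, Pi.add_apply]; ring

theorem det2_add_right (a b c : Fin 2 → ℤ) : det2 a (b + c) = det2 a b + det2 a c := by
  simp only [det2, Pi.add_apply]; ring

theorem det2_mulVec (g : Matrix.SpecialLinearGroup (Fin 2) ℤ) (a b : Fin 2 → ℤ) :
    det2 ((g : Matrix (Fin 2) (Fin 2) ℤ).mulVec a) ((g : Matrix (Fin 2) (Fin 2) ℤ).mulVec b)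
      = det2 a b := by
  have h := g.det_coe
  rw [Matrix.det_fin_two] at h
  simp only [det2, Matrix.mulVec, dotProduct, Fin.sum_univ_two]
  linear_combination (a 0 * b 1 - a 1 * b 0) * h

theorem det2_neg_self (a : Fin 2 → ℤ) : det2 a (-a) = 0 := by
  simp only [det2, Pi.neg_apply]; ring

theorem det2_neg_self_left (a : Fin 2 → ℤ) : det2 (-a) a = 0 := by
  simp only [det2, Pi.neg_apply]; ring

theorem det2_zero_left (a : Fin 2 → ℤ) : det2 0 a = 0 := by simp [det2]

theorem det2_zero_right (a : Fin 2 → ℤ) : det2 a 0 = 0 := by simp [det2]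

/-- For any character `χ` of the abelian group `H`, the set `Γ₀ = Ĥ × ℤ² × SL(2,ℤ)` with
multiplication `(c₁, k, γ₁)·(c₂, l, γ₂) = (c₁·c₂·χ^{det(k, γ₁·l)}, k + γ₁·l, γ₁γ₂)` is a
group with identity `(1, 0, I)`. -/
theorem gamma0_is_group {H : Type*} [AddCommGroup H] (χ : CharGroup H) :
    (∀ x y z : Gamma0 H, gamma0Mul χ (gamma0Mul χ x y) z = gamma0Mul χ x (gamma0Mul χ y z)) ∧
    (∀ x : Gamma0 H, gamma0Mul χ (gamma0One H) x = x ∧ gamma0Mul χ x (gamma0One H) = x) ∧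
    (∀ x : Gamma0 H, ∃ y : Gamma0 H,
      gamma0Mul χ x y = gamma0One H ∧ gamma0Mul χ y x = gamma0One H) := by
  refine ⟨?_, ?_, ?_⟩
  · rintro ⟨c₁, k, g₁⟩ ⟨c₂, l, g₂⟩ ⟨c₃, m, g₃⟩
    simp only [gamma0Mul]
    refine Prod.ext ?_ (Prod.ext ?_ ?_)
    · simp only [Matrix.SpecialLinearGroup.coe_mul, ← Matrix.mulVec_mulVec, Matrix.mulVec_add,
        det2_add_left, det2_add_right, det2_mulVec, zpow_add]
      simp only [mul_assoc, mul_comm, mul_left_comm]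
    · simp only [Matrix.SpecialLinearGroup.coe_mul, ← Matrix.mulVec_mulVec, Matrix.mulVec_add,
        add_assoc]
    · exact mul_assoc _ _ _
  · rintro ⟨c, k, g⟩
    simp [gamma0Mul, gamma0One, det2_zero_left, det2_zero_right]
  · rintro ⟨c, k, g⟩
    have h1 : (g : Matrix (Fin 2) (Fin 2) ℤ).mulVec
        (((g⁻¹ : Matrix.SpecialLinearGroup (Fin 2) ℤ) : Matrix (Fin 2) (Fin 2) ℤ).mulVec k)
        = k := by
      rw [Matrix.mulVec_mulVec, ← Matrix.SpecialLinearGroup.coe_mul, mul_inv_cancel,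
        Matrix.SpecialLinearGroup.coe_one, Matrix.one_mulVec]
    refine ⟨(c⁻¹, -(((g⁻¹ : Matrix.SpecialLinearGroup (Fin 2) ℤ) :
      Matrix (Fin 2) (Fin 2) ℤ).mulVec k), g⁻¹), ?_, ?_⟩
    · simp only [gamma0Mul, gamma0One, Matrix.mulVec_neg, h1, det2_neg_self, zpow_zero,
        mul_inv_cancel, mul_one, add_neg_cancel]
    · simp only [gamma0Mul, gamma0One, det2_neg_self_left, zpow_zero,
        inv_mul_cancel, mul_one, neg_add_cancel]
end

section
/- Let H be an abelian group, χ a character of H, and λ: ℤ² → H a finitely supported function. For k ∈ ℤ² set w_k(λ) = ∏_{m∈ℤ²} χ(λ(m))^{det(k,m)}, and for l ∈ ℤ² let l·λ be the translated function (l·λ)(m) = λ(m − l). Then for all k, l ∈ ℤ²: w_l(λ) · w_k(l·λ) = χ(∑_{m∈ℤ²} λ(m))^{det(k,l)} · w_{k+l}(λ). -/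
/-- `w_k(λ) = ∏_{m ∈ ℤ²} χ(λ(m))^{det(k,m)}`, for a character `χ : H → 𝕋` and a finitely
supported `λ : ℤ² → H` (all but finitely many factors are `1`). -/
noncomputable def wFactor {H : Type*} [AddCommGroup H] (χ : Multiplicative H →* Circle)
    (k : Fin 2 → ℤ) (l : (Fin 2 → ℤ) →₀ H) : Circle :=
  ∏ᶠ m : Fin 2 → ℤ, χ (Multiplicative.ofAdd (l m)) ^ det2 k m

/-- The translate `l·λ` of `λ` by `l ∈ ℤ²`: `(l·λ)(m) = λ(m - l)`. -/
def translateFinsupp {H : Type*} [AddCommGroup H] (t : Fin 2 → ℤ)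
    (l : (Fin 2 → ℤ) →₀ H) : (Fin 2 → ℤ) →₀ H :=
  Finsupp.equivMapDomain (Equiv.addRight t) l

theorem wFactor_eq_prod_aux {H : Type*} [AddCommGroup H] (χ : Multiplicative H →* Circle)
    (l : (Fin 2 → ℤ) →₀ H) (e : (Fin 2 → ℤ) → ℤ) :
    ∏ᶠ m : Fin 2 → ℤ, χ (Multiplicative.ofAdd (l m)) ^ e m
      = ∏ m ∈ l.support, χ (Multiplicative.ofAdd (l m)) ^ e m := by
  apply finprod_eq_prod_of_mulSupport_subset
  intro m hm
  simp only [Finset.mem_coe, Finsupp.mem_support_iff]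
  intro h
  apply hm
  simp [h]

/-- For all `k, l ∈ ℤ²`:
`w_l(λ) · w_k(l·λ) = χ(∑_m λ(m))^{det(k,l)} · w_{k+l}(λ)`. -/
theorem wFactor_mul_translate {H : Type*} [AddCommGroup H]
    (χ : Multiplicative H →* Circle) (l : (Fin 2 → ℤ) →₀ H) (k t : Fin 2 → ℤ) :
    wFactor χ t l * wFactor χ k (translateFinsupp t l)
      = χ (Multiplicative.ofAdd (∑ m ∈ l.support, l m)) ^ det2 k t
          * wFactor χ (k + t) l := by
  have h : wFactor χ k (translateFinsupp t l)
      = ∏ᶠ m : Fin 2 → ℤ, χ (Multiplicative.ofAdd (l m)) ^ det2 k (m + t) := by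
    unfold wFactor
    rw [← finprod_comp_equiv (Equiv.addRight t)]
    simp [translateFinsupp, Finsupp.equivMapDomain_apply]
  rw [h]
  unfold wFactor
  rw [wFactor_eq_prod_aux, wFactor_eq_prod_aux, wFactor_eq_prod_aux, ofAdd_sum, map_prod,
    ← Finset.prod_zpow, ← Finset.prod_mul_distrib, ← Finset.prod_mul_distrib]
  refine Finset.prod_congr rfl fun m _ => ?_
  rw [← zpow_add, ← zpow_add]
  congr 1
  simp only [det2, Pi.add_apply]
  ring
end

section
/- Let H be an abelian group, let δ ∈ SL(2,ℤ) be the matrix with rows (1,1) and (0,1), and let D = {(n,0) : n ∈ ℤ} ⊆ ℤ². If λ: ℤ² → H is a finitely supported function whose support is not contained in D, then the orbit {δⁿ·λ : n ∈ ℤ} is infinite, where (γ·λ)(k) = λ(γ⁻¹·k) for γ ∈ SL(2,ℤ). -/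
/-- The action of `γ ∈ SL(2,ℤ)` on `ℤ²` by matrix multiplication, as an equivalence
(with inverse given by the action of `γ⁻¹`). -/
def sl2Equiv (γ : Matrix.SpecialLinearGroup (Fin 2) ℤ) : (Fin 2 → ℤ) ≃ (Fin 2 → ℤ) where
  toFun k := (γ : Matrix (Fin 2) (Fin 2) ℤ).mulVec k
  invFun k := ((γ⁻¹ : Matrix.SpecialLinearGroup (Fin 2) ℤ) : Matrix (Fin 2) (Fin 2) ℤ).mulVec k
  left_inv k := by
    show ((γ⁻¹ : Matrix.SpecialLinearGroup (Fin 2) ℤ) : Matrix (Fin 2) (Fin 2) ℤ).mulVec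
      ((γ : Matrix (Fin 2) (Fin 2) ℤ).mulVec k) = k
    rw [Matrix.mulVec_mulVec, ← Matrix.SpecialLinearGroup.coe_mul, inv_mul_cancel,
      Matrix.SpecialLinearGroup.coe_one, Matrix.one_mulVec]
  right_inv k := by
    show (γ : Matrix (Fin 2) (Fin 2) ℤ).mulVec
      (((γ⁻¹ : Matrix.SpecialLinearGroup (Fin 2) ℤ) : Matrix (Fin 2) (Fin 2) ℤ).mulVec k) = k
    rw [Matrix.mulVec_mulVec, ← Matrix.SpecialLinearGroup.coe_mul, mul_inv_cancel,
      Matrix.SpecialLinearGroup.coe_one, Matrix.one_mulVec]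

/-- The action of `SL(2,ℤ)` on finitely supported functions `λ : ℤ² → H`:
`(γ·λ)(k) = λ(γ⁻¹·k)`. -/
def sl2ActFinsupp {H : Type*} [AddCommGroup H] (γ : Matrix.SpecialLinearGroup (Fin 2) ℤ)
    (l : (Fin 2 → ℤ) →₀ H) : (Fin 2 → ℤ) →₀ H :=
  Finsupp.equivMapDomain (sl2Equiv γ) l

/-- The matrix `δ = [[1,1],[0,1]] ∈ SL(2,ℤ)`. -/
def deltaSL : Matrix.SpecialLinearGroup (Fin 2) ℤ :=
  ⟨!![1, 1; 0, 1], by simp [Matrix.det_fin_two_of]⟩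

/-- If the support of a finitely supported function `λ : ℤ² → H` is not contained in
`D = {(n,0) : n ∈ ℤ}`, then the orbit `{δⁿ·λ : n ∈ ℤ}` is infinite. -/
theorem orbit_infinite_of_support_not_subset {H : Type*} [AddCommGroup H]
    (l : (Fin 2 → ℤ) →₀ H)
    (hl : ¬ (↑l.support : Set (Fin 2 → ℤ)) ⊆ {k : Fin 2 → ℤ | k 1 = 0}) :
    Set.Infinite {l' : (Fin 2 → ℤ) →₀ H | ∃ n : ℤ, l' = sl2ActFinsupp (deltaSL ^ n) l} := by
  intro hfin
  obtain ⟨k, hk, hk1⟩ := Set.not_subset.1 hl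
  have hk1' : k 1 ≠ 0 := hk1
  have hk0 : l k ≠ 0 := Finsupp.mem_support_iff.1 hk
  have hU : (⋃ l' ∈ {l' : (Fin 2 → ℤ) →₀ H | ∃ n : ℤ, l' = sl2ActFinsupp (deltaSL ^ n) l},
      (↑l'.support : Set (Fin 2 → ℤ))).Finite :=
    hfin.biUnion fun l' _ => l'.support.finite_toSet
  have hinj : Function.Injective (fun n : ℤ => sl2Equiv (deltaSL ^ n) k) := by
    have key : ∀ n : ℤ, sl2Equiv (deltaSL ^ n) k 0 = k 0 + n * k 1 := by
      intro n
      have hT : deltaSL = ModularGroup.T := rfl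
      show ((deltaSL ^ n : Matrix.SpecialLinearGroup (Fin 2) ℤ) :
        Matrix (Fin 2) (Fin 2) ℤ).mulVec k 0 = _
      rw [hT, ModularGroup.coe_T_zpow]
      simp [Matrix.mulVec, dotProduct, Fin.sum_univ_two]
    intro m n hmn
    have h := congrFun hmn 0
    simp only [key] at h
    exact mul_right_cancel₀ hk1' (add_left_cancel h)
  refine Set.infinite_range_of_injective hinj (hU.subset ?_)
  rintro _ ⟨n, rfl⟩
  refine Set.mem_biUnion (x := sl2ActFinsupp (deltaSL ^ n) l) ⟨n, rfl⟩ ?_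
  simpa [sl2ActFinsupp, Finsupp.equivMapDomain_apply] using hk0
end

section
/- Let H be an abelian group and c: H → {1,-1} ⊆ 𝕋 a group homomorphism. Then for every λ ∈ Λ(H) and every k ∈ ℤ²: ∏_{l∈ℤ²} c(λ(l))^{gcd(k+l)} = (∏_{l∈ℤ²} c(λ(l))^{gcd(l)}) · (∏_{l∈ℤ²} c(λ(l))^{det(k,l)}). -/
/-- `gcd(k)` : the nonnegative greatest common divisor of the two entries of `k ∈ ℤ²`
(equal to `0` when `k = (0,0)`). -/
def gcd2 (k : Fin 2 → ℤ) : ℕ := Int.gcd (k 0) (k 1)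

theorem gcd2_even_iff (k : Fin 2 → ℤ) : Even (gcd2 k) ↔ Even (k 0) ∧ Even (k 1) := by
  rw [even_iff_two_dvd, even_iff_two_dvd, even_iff_two_dvd, gcd2]
  have h := Int.dvd_coe_gcd_iff (a := k 0) (b := k 1) (c := 2)
  rw [← h]
  exact_mod_cast Iff.rfl

theorem gcd2_parity (k m : Fin 2 → ℤ) :
    Even (((gcd2 k + gcd2 m : ℕ) : ℤ) + det2 k m) ↔ Even (gcd2 (k + m)) := by
  rw [Int.even_add, Int.even_coe_nat, Nat.even_add]
  simp only [gcd2_even_iff, det2, Pi.add_apply, Int.even_sub, Int.even_mul, Int.even_add]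
  tauto

theorem sign_pow_gcd2 (e : ℂ) (he : e = 1 ∨ e = -1) (k m : Fin 2 → ℤ) :
    e ^ gcd2 (k + m) = e ^ gcd2 m * e ^ det2 k m * e ^ gcd2 k := by
  rcases he with rfl | rfl
  · simp
  · have h : ((-1 : ℂ) ^ gcd2 m * (-1) ^ det2 k m * (-1) ^ gcd2 k)
        = (-1 : ℂ) ^ (((gcd2 k + gcd2 m : ℕ) : ℤ) + det2 k m) := by
      rw [zpow_add₀ (by norm_num), zpow_natCast, pow_add]
      ring
    rw [h]
    have hp := gcd2_parity k m
    by_cases hh : Even (gcd2 (k + m))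
    · rw [hh.neg_one_pow, (hp.2 hh).neg_one_zpow]
    · have h2 := mt hp.1 hh
      rw [(Nat.not_even_iff_odd.1 hh).neg_one_pow, (Int.not_even_iff_odd.1 h2).neg_one_zpow]

/-- Let `c : H → {1,-1} ⊆ 𝕋` be a group homomorphism. Then for every `λ ∈ Λ(H)` and
every `k ∈ ℤ²`:
`∏_{l ∈ ℤ²} c(λ(l))^{gcd(k+l)}
  = (∏_{l ∈ ℤ²} c(λ(l))^{gcd(l)}) · (∏_{l ∈ ℤ²} c(λ(l))^{det(k,l)})`
(all but finitely many factors of each product are `1`). -/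
theorem finprod_gcd_shift {H : Type*} [AddCommGroup H] (c : H → ℂ)
    (hc_sign : ∀ h, c h = 1 ∨ c h = -1)
    (hc_hom : ∀ g h, c (g + h) = c g * c h)
    (l : (Fin 2 → ℤ) →₀ H) (hl : InLambda l) (k : Fin 2 → ℤ) :
    ∏ᶠ m : Fin 2 → ℤ, c (l m) ^ gcd2 (k + m)
      = (∏ᶠ m : Fin 2 → ℤ, c (l m) ^ gcd2 m)
        * ∏ᶠ m : Fin 2 → ℤ, c (l m) ^ det2 k m := by
  have hc0 : c 0 = 1 := by
    have h := hc_hom 0 0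
    rw [add_zero] at h
    rcases hc_sign 0 with h1 | h1
    · exact h1
    · rw [h1] at h; norm_num at h
  have hsum : ∀ s : Finset (Fin 2 → ℤ), c (∑ m ∈ s, l m) = ∏ m ∈ s, c (l m) := by
    intro s
    induction s using Finset.induction_on with
    | empty => simpa using hc0
    | insert a s ha ih => rw [Finset.sum_insert ha, Finset.prod_insert ha, hc_hom, ih]
  have hone : ∀ m, m ∉ l.support → c (l m) = 1 := by
    intro m hm
    rw [Finsupp.notMem_support_iff.1 hm, hc0]
  have key : ∀ f : (Fin 2 → ℤ) → ℂ, (∀ m, m ∉ l.support → f m = 1) →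
      ∏ᶠ m, f m = ∏ m ∈ l.support, f m := by
    intro f hf
    apply finprod_eq_prod_of_mulSupport_subset
    intro m hm
    by_contra h
    exact hm (hf m h)
  rw [key _ (fun m hm => by rw [hone m hm, one_pow]),
    key _ (fun m hm => by rw [hone m hm, one_pow]),
    key _ (fun m hm => by rw [hone m hm, one_zpow]),
    Finset.prod_congr rfl (fun m _ => sign_pow_gcd2 (c (l m)) (hc_sign _) k m),
    Finset.prod_mul_distrib, Finset.prod_mul_distrib, Finset.prod_pow _ (gcd2 k), ← hsum,
    show ∑ m ∈ l.support, l m = 0 from hl, hc0, one_pow, mul_one]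
end

section
/- Let H be a nontrivial abelian group and μ a normalized scalar 2-cocycle on H. Then the following are equivalent: (i) for every g ∈ H with g ≠ 0 there exists h ∈ H with μ(g,h) ≠ μ(h,g); (ii) for every λ₁ ∈ Λ(H) with λ₁ ≠ 0 there exists λ₂ ∈ Λ(H) with conj(μ̃(λ₂,λ₁))·μ̃(λ₁,λ₂) ≠ 1. -/
theorem tilde_norm_aux {H : Type*} [AddCommGroup H]
    (μ : H → H → ℂ) (hμ : IsNormalized2Cocycle μ) (l₁ l₂ : (Fin 2 → ℤ) →₀ H) :
    ‖tilde2Cocycle μ l₁ l₂‖ = 1 := by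
  unfold tilde2Cocycle
  refine finprod_induction (fun z : ℂ => ‖z‖ = 1) (by simp) ?_ ?_
  · intro x y hx hy
    simp [hx, hy]
  · intro i
    exact hμ.1 _ _

theorem conj_mul_eq_one_iff_aux (z w : ℂ) (hz : ‖z‖ = 1) :
    (starRingEnd ℂ) z * w = 1 ↔ w = z := by
  have h1 : (starRingEnd ℂ) z * z = 1 := by
    rw [Complex.conj_mul', hz]; simp
  have h0 : (starRingEnd ℂ) z ≠ 0 := left_ne_zero_of_mul_eq_one h1
  constructor
  · intro h
    exact mul_left_cancel₀ h0 (h.trans h1.symm)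
  · rintro rfl
    exact h1

theorem central_neg_aux {H : Type*} [AddCommGroup H]
    (μ : H → H → ℂ) (hμ : IsNormalized2Cocycle μ) (g : H) (hg : ∀ h, μ g h = μ h g) (h : H) :
    μ (-g) h = μ h (-g) := by
  obtain ⟨hn, h1, h2, hc⟩ := hμ
  have e1 := hc g (-g) h
  have e2 := hc h (-g) g
  rw [add_neg_cancel, h2] at e1
  rw [neg_add_cancel, h1, ← hg (h + -g), ← hg (-g)] at e2
  rw [add_comm (-g) h] at e1
  have h0 : μ g (h + -g) ≠ 0 := by
    intro h0
    have := hn g (h + -g)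
    simp [h0] at this
  apply mul_right_cancel₀ h0
  rw [← e1, e2]

theorem inLambda_pair_aux {H : Type*} [AddCommGroup H] (k m : Fin 2 → ℤ) (h : H) :
    InLambda (Finsupp.single k h - Finsupp.single m h) := by
  have : ((Finsupp.single k h - Finsupp.single m h).sum fun _ x => x) = 0 := by
    rw [Finsupp.sum_sub_index (by intros; rfl)]
    simp
  exact this

theorem nondegenerate_iff_tilde_nondegenerate {H : Type*} [AddCommGroup H] [Nontrivial H]
    (μ : H → H → ℂ) (hμ : IsNormalized2Cocycle μ) :
    (∀ g : H, g ≠ 0 → ∃ h : H, μ g h ≠ μ h g) ↔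
      (∀ l₁ : (Fin 2 → ℤ) →₀ H, InLambda l₁ → l₁ ≠ 0 →
        ∃ l₂ : (Fin 2 → ℤ) →₀ H, InLambda l₂ ∧
          (starRingEnd ℂ) (tilde2Cocycle μ l₂ l₁) * tilde2Cocycle μ l₁ l₂ ≠ 1) := by
  classical
  constructor
  · intro hi l₁ _ hne
    obtain ⟨k, hk⟩ := Finsupp.ne_iff.mp hne
    obtain ⟨m, hm⟩ := Infinite.exists_notMem_finset l₁.support
    obtain ⟨h, hh⟩ := hi (l₁ k) hk
    have hm0 : l₁ m = 0 := by simpa using hm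
    have hkm : k ≠ m := by
      rintro rfl
      exact hk hm0
    refine ⟨Finsupp.single k h - Finsupp.single m h, inLambda_pair_aux k m h, ?_⟩
    rw [Ne, conj_mul_eq_one_iff_aux _ _ (tilde_norm_aux μ hμ _ _)]
    unfold tilde2Cocycle
    have key : ∀ x, x ≠ k → l₁ x = 0 ∨ (Finsupp.single k h - Finsupp.single m h) x = 0 := by
      intro x hx
      by_cases hxm : x = m
      · left; rw [hxm, hm0]
      · right; simp [Finsupp.single_apply, Ne.symm hx, Ne.symm hxm]
    rw [finprod_eq_single _ k, finprod_eq_single _ k]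
    · simpa [Finsupp.single_apply, hkm.symm] using hh
    · intro x hx
      rcases key x hx with e | e <;> rw [e]
      · exact hμ.2.1 _
      · exact hμ.2.2.1 _
    · intro x hx
      rcases key x hx with e | e <;> rw [e]
      · exact hμ.2.2.1 _
      · exact hμ.2.1 _
  · intro hii g hg
    by_contra hcon
    push Not at hcon
    obtain ⟨l₂, _, h2⟩ := hii (Finsupp.single 0 g - Finsupp.single 1 g)
      (inLambda_pair_aux 0 1 g) (by
        intro h0
        have := DFunLike.congr_fun h0 (0 : Fin 2 → ℤ)
        simp [Finsupp.single_apply] at this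
        exact hg this)
    apply h2
    rw [conj_mul_eq_one_iff_aux _ _ (tilde_norm_aux μ hμ _ _)]
    unfold tilde2Cocycle
    refine finprod_congr fun x => ?_
    by_cases hx0 : x = 0
    · subst hx0
      simpa [Finsupp.single_apply] using hcon _
    · by_cases hx1 : x = 1
      · subst hx1
        simpa [Finsupp.single_apply] using central_neg_aux μ hμ g hcon _
      · have : (Finsupp.single 0 g - Finsupp.single 1 g : (Fin 2 → ℤ) →₀ H) x = 0 := by
          simp [Finsupp.single_apply, Ne.symm hx0, Ne.symm hx1]
        rw [this, hμ.2.1, hμ.2.2.1]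
end
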